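/- arXiv:2305.11971 — 2 statements merged into one kernel-verified Lean document; each statement's English description precedes it below -/
import Mathlib

section
/- Let X and Y be real-valued random variables on a probability space (Ω, P), and for each n ≥ 1 let L_n := max_{1≤j≤n} |X + 2|Y|·cos(πj/(n+1))|. Then for every real y: lim_{n→∞} P(L_n ≤ y) = P(max(|X−2|Y||, |X+2|Y||) ≤ y). -/
open MeasureTheory ProbabilityTheory Filter

/-- Largest singular value of the `n × n` random symmetric tridiagonal Toeplitz matrix
with diagonal `X ω` and off-diagonal `Y ω`. -/
noncomputable def symSmax {Ω : Type*} (X Y : Ω → ℝ) (n : ℕ) (ω : Ω) : ℝ :=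
  ⨆ j : (Finset.Icc 1 n : Finset ℕ),
    |X ω + 2 * |Y ω| * Real.cos (Real.pi * ((j : ℕ) : ℝ) / ((n : ℝ) + 1))|

theorem measurable_symSmax {Ω : Type*} [MeasurableSpace Ω] {X Y : Ω → ℝ}
    (hX : Measurable X) (hY : Measurable Y) (n : ℕ) : Measurable (symSmax X Y n) := by
  unfold symSmax
  refine Measurable.iSup fun j => ?_
  have hY' : Measurable fun ω => |Y ω| := hY.abs
  exact (hX.add ((hY'.const_mul 2).mul_const _)).abs

theorem le_symSmax {Ω : Type*} (X Y : Ω → ℝ) {n j : ℕ} (hj : j ∈ Finset.Icc 1 n) (ω : Ω) :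
    |X ω + 2 * |Y ω| * Real.cos (Real.pi * (j : ℝ) / ((n : ℝ) + 1))| ≤ symSmax X Y n ω :=
  le_ciSup (f := fun j : (Finset.Icc 1 n : Finset ℕ) =>
    |X ω + 2 * |Y ω| * Real.cos (Real.pi * ((j : ℕ) : ℝ) / ((n : ℝ) + 1))|)
    (Set.finite_range _).bddAbove ⟨j, hj⟩

theorem symSmax_le {Ω : Type*} (X Y : Ω → ℝ) (n : ℕ) (ω : Ω) :
    symSmax X Y n ω ≤ max (abs (X ω - 2 * |Y ω|)) (abs (X ω + 2 * |Y ω|)) := by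
  refine Real.iSup_le (fun j => ?_) (le_max_of_le_left (abs_nonneg _))
  have hY := abs_nonneg (Y ω)
  refine abs_le_max_abs_abs ?_ ?_
  · nlinarith [Real.neg_one_le_cos (Real.pi * ((j : ℕ) : ℝ) / ((n : ℝ) + 1))]
  · nlinarith [Real.cos_le_one (Real.pi * ((j : ℕ) : ℝ) / ((n : ℝ) + 1))]

theorem eventually_lt_symSmax {Ω : Type*} (X Y : Ω → ℝ) {y : ℝ} {ω : Ω}
    (h : y < max (abs (X ω - 2 * |Y ω|)) (abs (X ω + 2 * |Y ω|))) :
    ∀ᶠ n : ℕ in atTop, y < symSmax X Y n ω := by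
  have key {θ : ℝ} {j : ℕ → ℕ} (hj : ∀ n, 1 ≤ n → j n ∈ Finset.Icc 1 n)
      (hθ : Tendsto (fun n : ℕ => Real.pi * (j n : ℝ) / ((n : ℝ) + 1)) atTop (nhds θ))
      (hy : y < |X ω + 2 * |Y ω| * Real.cos θ|) : ∀ᶠ n : ℕ in atTop, y < symSmax X Y n ω := by
    have hlim := ((((Real.continuous_cos.tendsto θ).comp hθ).const_mul
      (2 * |Y ω|)).const_add (X ω)).abs
    filter_upwards [hlim.eventually_const_lt hy, eventually_ge_atTop 1] with n hn h1
    exact hn.trans_le (le_symSmax X Y (hj n h1) ω)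
  rcases lt_max_iff.1 h with h | h
  · refine key (θ := Real.pi) (j := id) (fun n hn => Finset.mem_Icc.2 ⟨hn, le_rfl⟩) ?_
      (by simpa [sub_eq_add_neg] using h)
    simpa [mul_div_assoc] using (tendsto_natCast_div_add_atTop (1 : ℝ)).const_mul Real.pi
  · refine key (θ := 0) (j := fun _ => 1) (fun n hn => Finset.mem_Icc.2 ⟨le_rfl, hn⟩) ?_
      (by simpa using h)
    simpa [div_eq_mul_inv] using (tendsto_one_div_add_atTop_nhds_zero_nat (𝕜 := ℝ)).const_mul
      Real.pi

theorem stmt8 {Ω : Type*} [MeasureSpace Ω] [IsProbabilityMeasure (ℙ : Measure Ω)]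
    (X Y : Ω → ℝ) (hX : Measurable X) (hY : Measurable Y) (y : ℝ) :
    Tendsto (fun n : ℕ => ℙ {ω | symSmax X Y n ω ≤ y}) atTop
      (nhds (ℙ {ω | max (abs (X ω - 2 * |Y ω|)) (abs (X ω + 2 * |Y ω|)) ≤ y})) := by
  refine tendsto_measure_of_tendsto_indicator_of_isFiniteMeasure atTop ℙ
    (fun n => measurableSet_le (measurable_symSmax hX hY n) measurable_const) fun ω => ?_
  by_cases h : max (abs (X ω - 2 * |Y ω|)) (abs (X ω + 2 * |Y ω|)) ≤ y
  · exact Eventually.of_forall fun n => iff_of_true ((symSmax_le X Y n ω).trans h) h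
  · filter_upwards [eventually_lt_symSmax X Y (not_le.1 h)] with n hn
    exact iff_of_false (not_le.2 hn) h
end

section
/- Let X and Y be real-valued random variables on a probability space (Ω, P), and for each n ≥ 1 let S_n := min_{1≤j≤n} |X + 2|Y|·cos(πj/(n+1))|. Let m := min(|X−2|Y||, |X+2|Y||) and W₀ := 0 if |X| ≤ 2|Y|, W₀ := m if |X| > 2|Y|. Then for every real x with P(W₀ = x) = 0: lim_{n→∞} P(S_n ≤ x) = 1 − P(x < 0 and |X| ≤ 2|Y|) − P(x < m and |X| > 2|Y|). -/
open MeasureTheory ProbabilityTheory Filter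

/-- Smallest singular value of the `n × n` random symmetric tridiagonal Toeplitz matrix
with diagonal `X ω` and off-diagonal `Y ω`. -/
noncomputable def symSmin {Ω : Type*} (X Y : Ω → ℝ) (n : ℕ) (ω : Ω) : ℝ :=
  ⨅ j : (Finset.Icc 1 n : Finset ℕ),
    |X ω + 2 * |Y ω| * Real.cos (Real.pi * ((j : ℕ) : ℝ) / ((n : ℝ) + 1))|

open Set Topology in
/-- If a continuous function attains its global minimum at `θ ∈ [0, π]`, its minima over the grids
`{π j / (n + 1) : 1 ≤ j ≤ n}` converge to that minimum. -/
theorem tendsto_iInf_grid_of_isMin {g : ℝ → ℝ} (hg : Continuous g) {θ : ℝ}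
    (h0 : 0 ≤ θ) (hpi : θ ≤ Real.pi) (hmin : ∀ φ, g θ ≤ g φ) :
    Tendsto (fun n : ℕ => ⨅ j : (Finset.Icc 1 n : Finset ℕ),
      g (Real.pi * ((j : ℕ) : ℝ) / ((n : ℝ) + 1))) atTop (𝓝 (g θ)) := by
  have hπ := Real.pi_pos
  let k : ℕ → ℕ := fun n => min n (⌊θ / Real.pi * ((n : ℝ) + 1)⌋₊ + 1)
  have hk : ∀ n, |(k n : ℝ) - θ / Real.pi * ((n : ℝ) + 1)| ≤ 1 := by
    intro n
    have ht0 : 0 ≤ θ / Real.pi * ((n : ℝ) + 1) := by positivity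
    have ht1 : θ / Real.pi * ((n : ℝ) + 1) ≤ (n : ℝ) + 1 :=
      mul_le_of_le_one_left (by positivity) ((div_le_one hπ).2 hpi)
    have hfl := Nat.floor_le ht0
    have hlt := Nat.lt_floor_add_one (θ / Real.pi * ((n : ℝ) + 1))
    have hcast : (k n : ℝ) = min (n : ℝ) (⌊θ / Real.pi * ((n : ℝ) + 1)⌋₊ + 1) := by
      simp [k]
    rw [hcast, abs_le]
    constructor
    · have : θ / Real.pi * ((n : ℝ) + 1) - 1 ≤
          min (n : ℝ) (⌊θ / Real.pi * ((n : ℝ) + 1)⌋₊ + 1) :=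
        le_min (by linarith) (by linarith)
      linarith
    · have := min_le_right (n : ℝ) (⌊θ / Real.pi * ((n : ℝ) + 1)⌋₊ + 1)
      linarith
  have hgrid : Tendsto (fun n : ℕ => Real.pi * (k n : ℝ) / ((n : ℝ) + 1)) atTop (𝓝 θ) := by
    rw [tendsto_iff_dist_tendsto_zero]
    have hlim : Tendsto (fun n : ℕ => Real.pi * (1 / ((n : ℝ) + 1))) atTop (𝓝 0) := by
      simpa using tendsto_one_div_add_atTop_nhds_zero_nat.const_mul Real.pi
    refine squeeze_zero (fun _ => dist_nonneg) (fun n => ?_) hlim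
    have hn : (0 : ℝ) < (n : ℝ) + 1 := by positivity
    have heq : Real.pi * (k n : ℝ) / ((n : ℝ) + 1) - θ =
        Real.pi * (1 / ((n : ℝ) + 1)) * ((k n : ℝ) - θ / Real.pi * ((n : ℝ) + 1)) := by
      field_simp
    rw [Real.dist_eq, heq, abs_mul, abs_of_pos (by positivity)]
    exact mul_le_of_le_one_right (by positivity) (hk n)
  refine tendsto_of_tendsto_of_tendsto_of_le_of_le' tendsto_const_nhds
    ((hg.tendsto θ).comp hgrid) ?_ ?_
  · filter_upwards [eventually_ge_atTop 1] with n hn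
    have : Nonempty (Finset.Icc 1 n : Finset ℕ) := ⟨⟨1, by simpa using hn⟩⟩
    exact le_ciInf fun j => hmin _
  · filter_upwards [eventually_ge_atTop 1] with n hn
    exact ciInf_le (f := fun j : (Finset.Icc 1 n : Finset ℕ) =>
      g (Real.pi * ((j : ℕ) : ℝ) / ((n : ℝ) + 1)))
      ⟨g θ, by rintro _ ⟨j, rfl⟩; exact hmin _⟩
      ⟨k n, Finset.mem_Icc.2 ⟨le_min hn (by omega), min_le_left _ _⟩⟩

/-- The minimum over `φ` of `|a + 2 b cos φ|`, for `b ≥ 0`, is attained on `[0, π]`. -/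
theorem exists_isMin_abs_add_mul_cos (a : ℝ) {b : ℝ} (hb : 0 ≤ b) :
    ∃ θ, 0 ≤ θ ∧ θ ≤ Real.pi ∧
      |a + 2 * b * Real.cos θ| =
        (if |a| ≤ 2 * b then (0 : ℝ) else min |a - 2 * b| |a + 2 * b|) ∧
      ∀ φ, |a + 2 * b * Real.cos θ| ≤ |a + 2 * b * Real.cos φ| := by
  have hπ := Real.pi_pos
  by_cases h : |a| ≤ 2 * b
  · have hzero : a + 2 * b * Real.cos (Real.arccos (-a / (2 * b))) = 0 := by
      rcases hb.eq_or_lt with rfl | hb'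
      · simpa using h
      · obtain ⟨h1, h2⟩ := abs_le.1 h
        rw [Real.cos_arccos]
        · field_simp
          ring
        · rw [le_div_iff₀ (by positivity)]
          linarith
        · rw [div_le_iff₀ (by positivity)]
          linarith
    refine ⟨Real.arccos (-a / (2 * b)), Real.arccos_nonneg _, Real.arccos_le_pi _, ?_, ?_⟩
    · rw [hzero, if_pos h, abs_zero]
    · intro φ
      rw [hzero, abs_zero]
      positivity
  · rw [if_neg h]
    rw [not_le] at h
    have hlow : ∀ φ, -(2 * b) ≤ 2 * b * Real.cos φ := fun φ => by
      nlinarith [Real.neg_one_le_cos φ]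
    have hup : ∀ φ, 2 * b * Real.cos φ ≤ 2 * b := fun φ => by
      nlinarith [Real.cos_le_one φ]
    rcases lt_abs.1 h with h | h
    · refine ⟨Real.pi, hπ.le, le_rfl, ?_, fun φ => ?_⟩
      · rw [Real.cos_pi, abs_of_pos (show 0 < a - 2 * b by linarith),
          abs_of_pos (show 0 < a + 2 * b by linarith), min_eq_left (by linarith),
          abs_of_pos (by linarith)]
        ring
      · rw [Real.cos_pi, abs_of_pos (by linarith)]
        exact le_trans (by linarith [hlow φ]) (le_abs_self _)
    · refine ⟨0, le_rfl, hπ.le, ?_, fun φ => ?_⟩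
      · rw [Real.cos_zero, abs_of_neg (show a - 2 * b < 0 by linarith),
          abs_of_neg (show a + 2 * b < 0 by linarith), min_eq_right (by linarith),
          abs_of_neg (by linarith)]
        ring
      · rw [Real.cos_zero, abs_of_neg (by linarith)]
        exact le_trans (by linarith [hup φ]) (neg_le_abs _)

/-- The smallest singular value converges pointwise. -/
theorem tendsto_symSmin {Ω : Type*} (X Y : Ω → ℝ) (ω : Ω) :
    Tendsto (fun n => symSmin X Y n ω) atTop
      (nhds (if |X ω| ≤ 2 * |Y ω| then (0 : ℝ)
        else min (abs (X ω - 2 * |Y ω|)) (abs (X ω + 2 * |Y ω|)))) := by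
  obtain ⟨θ, h0, hpi, heq, hmin⟩ := exists_isMin_abs_add_mul_cos (X ω) (abs_nonneg (Y ω))
  rw [← heq]
  exact tendsto_iInf_grid_of_isMin (g := fun φ => |X ω + 2 * |Y ω| * Real.cos φ|)
    (by fun_prop) h0 hpi hmin

theorem measurable_symSmin {Ω : Type*} [MeasurableSpace Ω] {X Y : Ω → ℝ}
    (hX : Measurable X) (hY : Measurable Y) (n : ℕ) : Measurable (symSmin X Y n) := by
  unfold symSmin
  exact Measurable.iInf fun j => (hX.add ((hY.abs.const_mul 2).mul_const _)).abs

/-- Almost sure convergence implies convergence of distribution functions at every point which is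
not an atom of the limit. -/
theorem tendsto_measure_le_of_ae_tendsto {Ω : Type*} [MeasurableSpace Ω] {μ : Measure Ω}
    [IsFiniteMeasure μ] {S : ℕ → Ω → ℝ} {W : Ω → ℝ} (hS : ∀ n, Measurable (S n))
    (hW : Measurable W) (hlim : ∀ᵐ ω ∂μ, Tendsto (fun n => S n ω) atTop (nhds (W ω))) {x : ℝ}
    (hx : μ {ω | W ω = x} = 0) :
    Tendsto (fun n => μ {ω | S n ω ≤ x}) atTop (nhds (μ {ω | W ω ≤ x})) := by
  have hne : ∀ᵐ ω ∂μ, W ω ≠ x := by simpa [ae_iff] using hx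
  refine tendsto_measure_of_ae_tendsto_indicator_of_isFiniteMeasure atTop
    (measurableSet_le hW measurable_const) (fun n => measurableSet_le (hS n) measurable_const) ?_
  filter_upwards [hlim, hne] with ω hω hωx
  rcases hωx.lt_or_gt with h | h
  · filter_upwards [hω.eventually_lt_const h] with n hn
    simp [hn.le, h.le]
  · filter_upwards [hω.eventually_const_lt h] with n hn
    simp [hn.not_ge, h.not_ge]

theorem stmt9 {Ω : Type*} [MeasureSpace Ω] [IsProbabilityMeasure (ℙ : Measure Ω)]
    (X Y : Ω → ℝ) (hX : Measurable X) (hY : Measurable Y) (x : ℝ)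
    (hx : ℙ {ω | (if |X ω| ≤ 2 * |Y ω| then (0 : ℝ)
        else min (abs (X ω - 2 * |Y ω|)) (abs (X ω + 2 * |Y ω|))) = x} = 0) :
    Tendsto (fun n : ℕ => (ℙ {ω | symSmin X Y n ω ≤ x}).toReal) atTop
      (nhds (1 - (ℙ {ω | x < 0 ∧ |X ω| ≤ 2 * |Y ω|}).toReal
        - (ℙ {ω | x < min (abs (X ω - 2 * |Y ω|)) (abs (X ω + 2 * |Y ω|))
            ∧ 2 * |Y ω| < |X ω|}).toReal)) := by
  set W : Ω → ℝ := fun ω => if |X ω| ≤ 2 * |Y ω| then (0 : ℝ)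
    else min (abs (X ω - 2 * |Y ω|)) (abs (X ω + 2 * |Y ω|)) with hWdef
  have hY2 : Measurable fun ω => 2 * |Y ω| := hY.abs.const_mul 2
  have hm : Measurable fun ω => min (abs (X ω - 2 * |Y ω|)) (abs (X ω + 2 * |Y ω|)) :=
    (hX.sub hY2).abs.min (hX.add hY2).abs
  have hle : MeasurableSet {ω | |X ω| ≤ 2 * |Y ω|} := measurableSet_le hX.abs hY2
  have hW : Measurable W := Measurable.ite hle measurable_const hm
  set A : Set Ω := {ω | x < 0 ∧ |X ω| ≤ 2 * |Y ω|}
  set B : Set Ω := {ω | x < min (abs (X ω - 2 * |Y ω|)) (abs (X ω + 2 * |Y ω|))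
    ∧ 2 * |Y ω| < |X ω|}
  have hB : MeasurableSet B :=
    (measurableSet_lt measurable_const hm).inter (measurableSet_lt hY2 hX.abs)
  have hdisj : Disjoint A B :=
    Set.disjoint_left.2 fun ω hA hB => hA.2.not_gt hB.2
  have hcompl : {ω | W ω ≤ x}ᶜ = A ∪ B := by
    ext ω
    by_cases h : |X ω| ≤ 2 * |Y ω|
    · simp [A, B, hWdef, h, h.not_gt]
    · simp [A, B, hWdef, h, not_le.1 h]
  have hval : 1 - (ℙ A).toReal - (ℙ B).toReal = (ℙ {ω | W ω ≤ x}).toReal := by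
    have h1 := probReal_compl_eq_one_sub (μ := (ℙ : Measure Ω))
      (measurableSet_le hW (measurable_const (a := x)))
    rw [hcompl, measureReal_union hdisj hB] at h1
    simp only [measureReal_def] at h1
    linarith
  rw [hval]
  exact (ENNReal.tendsto_toReal (measure_ne_top _ _)).comp
    (tendsto_measure_le_of_ae_tendsto (measurable_symSmin hX hY) hW
      (ae_of_all _ (tendsto_symSmin X Y)) hx)
end
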